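/- Let p be a prime and let K be a field of characteristic p that is complete with respect to a nontrivial nonarchimedean absolute value ‖·‖, and let U = {z ∈ K : ‖z−1‖ < 1}. For c ∈ ℤ_p and z ∈ U write z^c for the sum of the convergent series ∑_{n≥0} binom(c,n)·(z−1)^n (an element of U). Then for all c, d ∈ ℤ_p and all z ∈ U: z^{c+d} = z^c · z^d and (z^c)^d = z^{c·d}. Moreover the map ℤ_p → (U → U), c ↦ (z ↦ z^c), is injective. (Hence c ↦ (z ↦ z^c) identifies ℤ_p, as a ring, with a subring of the endomorphism ring of the abelian group U, addition corresponding to pointwise multiplication of characters and multiplication to composition.) -/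

import Mathlib

/-- For `c ∈ ℤ_p` and `z` in a field of characteristic `p`, the power `z ^ c` is defined as
the sum of the series `∑ binom (c, n) (z - 1) ^ n`, where `binom (c, n)` is the reduced
binomial coefficient in the prime field `𝔽_p ⊆ K`, realized as
`Nat.choose (PadicInt.appr c (n+1)) n` cast into `K`. -/
noncomputable def padicPow (p : ℕ) [Fact p.Prime] {K : Type*} [NormedField K]
    (c : ℤ_[p]) (z : K) : K :=
  ∑' n : ℕ, ((PadicInt.appr c (n + 1)).choose n : K) * (z - 1) ^ n

theorem Nat.ModEq.choose_of_lt_prime_pow {p : ℕ} [Fact p.Prime] {k a b n : ℕ}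
    (hab : a ≡ b [MOD p ^ k]) (hn : n < p ^ k) : a.choose n ≡ b.choose n [MOD p] := by
  induction k generalizing a b n with
  | zero =>
    obtain rfl : n = 0 := by simpa using hn
    simp [Nat.ModEq]
  | succ k ih =>
    have hp : 0 < p := (Fact.out : p.Prime).pos
    have hmod : a % p = b % p := hab.of_dvd (dvd_pow_self p k.succ_ne_zero)
    have hdiv : a / p ≡ b / p [MOD p ^ k] := by
      have h : a % (p * p ^ k) / p = b % (p * p ^ k) / p := by
        rw [← pow_succ', hab]
      rwa [Nat.mod_mul_right_div_self, Nat.mod_mul_right_div_self] at h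
    have hlt : n / p < p ^ k := by
      rwa [Nat.div_lt_iff_lt_mul hp, ← pow_succ]
    refine Choose.choose_modEq_choose_mod_mul_choose_div_nat.trans ?_
    rw [hmod]
    exact ((ih hdiv hlt).mul_left _).trans Choose.choose_modEq_choose_mod_mul_choose_div_nat.symm

theorem PadicInt.choose_appr_modEq {p : ℕ} [Fact p.Prime] {c : ℤ_[p]} {k m n : ℕ}
    (hm : (p : ℤ_[p]) ^ k ∣ c - m) (hn : n < p ^ k) :
    (c.appr (n + 1)).choose n ≡ m.choose n [MOD p] := by
  have key : ∀ j, j ≤ k → j ≤ n + 1 → c.appr (n + 1) ≡ m [MOD p ^ j] := by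
    intro j hjk hjn
    rw [← ZMod.natCast_eq_natCast_iff]
    refine PadicInt.zmod_congr_of_sub_mem_span j c _ _ ?_ ?_
    · rw [Ideal.mem_span_singleton]
      exact (pow_dvd_pow _ hjn).trans (Ideal.mem_span_singleton.1 (c.appr_spec (n + 1)))
    · rw [Ideal.mem_span_singleton]
      exact (pow_dvd_pow _ hjk).trans hm
  rcases le_total k (n + 1) with h | h
  · exact (key k le_rfl h).choose_of_lt_prime_pow hn
  · exact (key (n + 1) h le_rfl).choose_of_lt_prime_pow
      (n.lt_succ_self.trans (Nat.lt_pow_self (Fact.out : p.Prime).one_lt))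

section

variable {p : ℕ} [Fact p.Prime] {K : Type*} [NormedField K] [IsUltrametricDist K]

theorem norm_natCast_mul_pow_le (a n : ℕ) (x : K) : ‖(a : K) * x ^ n‖ ≤ ‖x‖ ^ n := by
  rw [norm_mul, norm_pow]
  exact mul_le_of_le_one_left (by positivity) (IsUltrametricDist.norm_natCast_le_one K a)

theorem summable_natCast_mul_pow [CompleteSpace K] (a : ℕ → ℕ) {x : K} (hx : ‖x‖ < 1) :
    Summable fun n ↦ (a n : K) * x ^ n :=
  (summable_geometric_of_lt_one (norm_nonneg x) hx).of_norm_bounded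
    fun n ↦ norm_natCast_mul_pow_le (a n) n x

theorem norm_eq_one_of_norm_sub_one_lt_one {z : K} (hz : ‖z - 1‖ < 1) : ‖z‖ = 1 := by
  have h := IsUltrametricDist.norm_add_eq_max_of_norm_ne_norm
    (x := z - 1) (y := 1) (by rw [norm_one]; exact hz.ne)
  rwa [sub_add_cancel, norm_one, max_eq_right hz.le] at h

theorem norm_pow_sub_pow_le_norm_sub {x y : K} (hx : ‖x‖ ≤ 1) (hy : ‖y‖ ≤ 1) (n : ℕ) :
    ‖x ^ n - y ^ n‖ ≤ ‖x - y‖ := by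
  rw [← geom_sum₂_mul, norm_mul]
  refine mul_le_of_le_one_left (norm_nonneg _) ?_
  refine IsUltrametricDist.norm_sum_le_of_forall_le_of_nonneg zero_le_one fun i _ ↦ ?_
  rw [norm_mul, norm_pow, norm_pow]
  exact mul_le_one₀ (pow_le_one₀ (norm_nonneg _) hx) (by positivity)
    (pow_le_one₀ (norm_nonneg _) hy)

variable [CompleteSpace K] [CharP K p]

/-- A natural number approximating the exponent modulo `p ^ k` approximates the power. -/
theorem norm_padicPow_sub_pow_le {c : ℤ_[p]} {k m : ℕ} (hm : (p : ℤ_[p]) ^ k ∣ c - m)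
    {z : K} (hz : ‖z - 1‖ < 1) : ‖padicPow p c z - z ^ m‖ ≤ ‖z - 1‖ ^ p ^ k := by
  have hpow : z ^ m = ∑' n : ℕ, ((m.choose n : ℕ) : K) * (z - 1) ^ n := by
    rw [tsum_eq_sum (s := Finset.range (m + 1))]
    · conv_lhs => rw [← sub_add_cancel z 1, add_pow]
      exact Finset.sum_congr rfl fun n _ ↦ by rw [one_pow, mul_one, mul_comm]
    · intro n hn
      rw [Nat.choose_eq_zero_of_lt (by simpa using hn), Nat.cast_zero, zero_mul]
  rw [hpow, padicPow, ← (summable_natCast_mul_pow _ hz).tsum_sub (summable_natCast_mul_pow _ hz)]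
  refine IsUltrametricDist.norm_tsum_le_of_forall_le_of_nonneg (by positivity) fun n ↦ ?_
  rcases lt_or_ge n (p ^ k) with hn | hn
  · rw [(CharP.cast_eq_iff_mod_eq K p).2 (PadicInt.choose_appr_modEq hm hn), sub_self, norm_zero]
    positivity
  · refine le_trans ?_ (pow_le_pow_of_le_one (norm_nonneg _) hz.le hn)
    rw [sub_eq_add_neg]
    refine (IsUltrametricDist.norm_add_le_max _ _).trans (max_le ?_ ?_)
    · exact norm_natCast_mul_pow_le _ _ _
    · rw [norm_neg]
      exact norm_natCast_mul_pow_le _ _ _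

theorem tendsto_pow_padicPow {c : ℤ_[p]} {m : ℕ → ℕ} (hm : ∀ k, (p : ℤ_[p]) ^ k ∣ c - m k)
    {z : K} (hz : ‖z - 1‖ < 1) :
    Filter.Tendsto (fun k ↦ z ^ m k) Filter.atTop (nhds (padicPow p c z)) := by
  rw [tendsto_iff_norm_sub_tendsto_zero]
  refine squeeze_zero (fun _ ↦ norm_nonneg _)
    (fun k ↦ (norm_sub_rev _ _).trans_le (norm_padicPow_sub_pow_le (hm k) hz)) ?_
  exact (tendsto_pow_atTop_nhds_zero_of_lt_one (norm_nonneg _) hz).comp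
    (tendsto_pow_atTop_atTop_of_one_lt (Fact.out : p.Prime).one_lt)

theorem pow_dvd_sub_appr (c : ℤ_[p]) (k : ℕ) : (p : ℤ_[p]) ^ k ∣ c - c.appr k :=
  Ideal.mem_span_singleton.1 (c.appr_spec k)

theorem norm_padicPow_sub_one_lt_one (c : ℤ_[p]) {z : K} (hz : ‖z - 1‖ < 1) :
    ‖padicPow p c z - 1‖ < 1 := by
  have h := norm_padicPow_sub_pow_le (k := 0) (m := 0) (c := c) (by simp) hz
  simp only [pow_zero, pow_one] at h
  exact h.trans_lt hz

theorem padicPow_natCast (n : ℕ) {z : K} (hz : ‖z - 1‖ < 1) :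
    padicPow p (n : ℤ_[p]) z = z ^ n :=
  tendsto_nhds_unique (tendsto_pow_padicPow (m := fun _ ↦ n) (by simp) hz) tendsto_const_nhds

theorem padicPow_one_right (c : ℤ_[p]) : padicPow p c (1 : K) = 1 :=
  tendsto_nhds_unique (tendsto_pow_padicPow (pow_dvd_sub_appr c) (by simp)) (by simp)

theorem padicPow_add (c d : ℤ_[p]) {z : K} (hz : ‖z - 1‖ < 1) :
    padicPow p (c + d) z = padicPow p c z * padicPow p d z := by
  refine tendsto_nhds_unique
    (tendsto_pow_padicPow (m := fun k ↦ c.appr k + d.appr k) (fun k ↦ ?_) hz) ?_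
  · rw [Nat.cast_add, add_sub_add_comm]
    exact dvd_add (pow_dvd_sub_appr c k) (pow_dvd_sub_appr d k)
  · simp only [pow_add]
    exact (tendsto_pow_padicPow (pow_dvd_sub_appr c) hz).mul
      (tendsto_pow_padicPow (pow_dvd_sub_appr d) hz)

theorem padicPow_mul (c d : ℤ_[p]) {z : K} (hz : ‖z - 1‖ < 1) :
    padicPow p (c * d) z = padicPow p d (padicPow p c z) := by
  have hw := norm_padicPow_sub_one_lt_one c hz
  refine tendsto_nhds_unique
    (tendsto_pow_padicPow (m := fun k ↦ c.appr k * d.appr k) (fun k ↦ ?_) hz) ?_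
  · have h : c * d - ((c.appr k * d.appr k : ℕ) : ℤ_[p]) =
        (c - c.appr k) * d + c.appr k * (d - d.appr k) := by
      push_cast
      ring
    rw [h]
    exact dvd_add ((pow_dvd_sub_appr c k).mul_right _) ((pow_dvd_sub_appr d k).mul_left _)
  · have hc := tendsto_iff_norm_sub_tendsto_zero.1 (tendsto_pow_padicPow (pow_dvd_sub_appr c) hz)
    have hdiff : Filter.Tendsto
        (fun k ↦ (z ^ c.appr k) ^ d.appr k - padicPow p c z ^ d.appr k)
        Filter.atTop (nhds 0) := by
      refine squeeze_zero_norm (fun k ↦ norm_pow_sub_pow_le_norm_sub ?_ ?_ _) hc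
      · rw [norm_pow, norm_eq_one_of_norm_sub_one_lt_one hz, one_pow]
      · exact (norm_eq_one_of_norm_sub_one_lt_one hw).le
    simpa [pow_mul] using hdiff.add (tendsto_pow_padicPow (pow_dvd_sub_appr d) hw)

/-- A one-unit other than `1` is not killed by any nonzero exponent. -/
theorem eq_zero_of_padicPow_eq_one {c : ℤ_[p]} {z : K} (hz : ‖z - 1‖ < 1) (hz1 : z ≠ 1)
    (h : padicPow p c z = 1) : c = 0 := by
  by_contra hc
  have hpow : z ^ p ^ c.valuation = padicPow p (c * ↑(PadicInt.unitCoeff hc)⁻¹) z := by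
    rw [← padicPow_natCast (p := p) _ hz]
    congr 1
    rw [eq_comm, Units.mul_inv_eq_iff_eq_mul, Nat.cast_pow, mul_comm]
    exact PadicInt.unitCoeff_spec hc
  rw [padicPow_mul _ _ hz, h, padicPow_one_right, ← sub_eq_zero] at hpow
  have hsub : (z - 1) ^ p ^ c.valuation = 0 := by
    rw [sub_pow_char_pow, one_pow, hpow]
  exact hz1 (sub_eq_zero.1 (pow_eq_zero_iff (pow_pos (Fact.out : p.Prime).pos _).ne' |>.1 hsub))

end

/-- **`ℤ_p` as the ring of locally analytic endomorphisms of the one-units.**  In a complete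
nonarchimedean field `K` of characteristic `p`, for all `c, d ∈ ℤ_p` and all one-units `z`
(`‖z - 1‖ < 1`) one has `z ^ (c + d) = z ^ c * z ^ d` and `(z ^ c) ^ d = z ^ (c * d)`;
moreover `c ↦ (z ↦ z ^ c)` is injective.  Hence `ℤ_p` embeds as a ring into the
endomorphisms of the group of one-units, addition corresponding to pointwise multiplication
of characters and multiplication to composition. -/
theorem padicPow_ring_identities
    (p : ℕ) [Fact p.Prime]
    (K : Type*) [NontriviallyNormedField K] [CompleteSpace K] [IsUltrametricDist K]
    [CharP K p] :
    (∀ (c d : ℤ_[p]) (z : K), ‖z - 1‖ < 1 →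
        padicPow p (c + d) z = padicPow p c z * padicPow p d z ∧
          padicPow p d (padicPow p c z) = padicPow p (c * d) z) ∧
      ∀ c d : ℤ_[p], (∀ z : K, ‖z - 1‖ < 1 → padicPow p c z = padicPow p d z) → c = d := by
  refine ⟨fun c d z hz ↦ ⟨padicPow_add c d hz, (padicPow_mul c d hz).symm⟩, fun c d h ↦ ?_⟩
  obtain ⟨x, hx0, hx1⟩ := NormedField.exists_norm_lt_one K
  have hz : ‖(x + 1) - 1‖ < 1 := by rwa [add_sub_cancel_right]
  have hz1 : x + 1 ≠ 1 := by simpa using hx0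
  refine sub_eq_zero.1 (eq_zero_of_padicPow_eq_one hz hz1 ?_)
  have hadd := padicPow_add (c - d) d hz
  rw [sub_add_cancel, h _ hz] at hadd
  have hd : padicPow p d (x + 1) ≠ 0 := by
    rw [← norm_ne_zero_iff,
      norm_eq_one_of_norm_sub_one_lt_one (norm_padicPow_sub_one_lt_one d hz)]
    exact one_ne_zero
  exact (mul_eq_right₀ hd).1 hadd.symm
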